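/- arXiv:2505.09218 — 8 statements merged into one kernel-verified Lean document; each statement's English description precedes it below -/
import Mathlib

section
/- Let L > 0, σ² ≥ 0, R ∈ ℕ, and 0 < γ with γ ≤ 1/(2RL) (this constraint is vacuous when R = 0). Let (F_k)_{k≥0}, (a_k)_{k≥0}, (b_k)_{k≥0} be sequences of nonnegative reals satisfying, for every k ≥ 0, F_{k+1} ≤ F_k − (γ/2)·a_k − (γ/4)·b_k + L·γ²·σ² + L²·γ³·R·Σ_{j=max(k−R,0)}^{k−1} b_j. Then for every integer K ≥ 1: (1/K)·Σ_{k=0}^{K−1} a_k ≤ 2F_0/(Kγ) + 2Lγσ². -/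
/-- In a sum over trailing windows of length at most `R`, each term of a nonnegative sequence is
counted at most `R` times. -/
theorem sum_range_sum_Ico_sub_le (b : ℕ → ℝ) (hb : ∀ k, 0 ≤ b k) (R K : ℕ) :
    ∑ k ∈ Finset.range K, ∑ j ∈ Finset.Ico (k - R) k, b j ≤
      (R : ℝ) * ∑ k ∈ Finset.range K, b k := by
  rw [Finset.sum_comm' (t' := Finset.range K)
    (s' := fun j => Finset.Ico (j + 1) (min (j + 1 + R) K))
    (by intro k j; simp only [Finset.mem_range, Finset.mem_Ico]; omega), Finset.mul_sum]
  refine Finset.sum_le_sum fun j _ => ?_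
  rw [Finset.sum_const, nsmul_eq_mul, Nat.card_Ico]
  have hcard : min (j + 1 + R) K - (j + 1) ≤ R := by omega
  exact mul_le_mul_of_nonneg_right (by exact_mod_cast hcard) (hb j)

/-- The deterministic telescoping step concluding the proof of the Main Theorem of
Birch SGD. Empty sums are `0`; the step-size restriction `γ ≤ 1/(2RL)` is vacuous
when `R = 0`. -/
theorem birch_sgd_telescoping
    (L σ2 : ℝ) (hL : 0 < L) (hσ2 : 0 ≤ σ2) (R : ℕ)
    (γ : ℝ) (hγ0 : 0 < γ) (hγR : R ≠ 0 → γ ≤ 1 / (2 * (R : ℝ) * L))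
    (F a b : ℕ → ℝ)
    (hF : ∀ k, 0 ≤ F k) (ha : ∀ k, 0 ≤ a k) (hb : ∀ k, 0 ≤ b k)
    (hrec : ∀ k, F (k + 1) ≤ F k - (γ / 2) * a k - (γ / 4) * b k + L * γ ^ 2 * σ2
      + L ^ 2 * γ ^ 3 * (R : ℝ) * ∑ j ∈ Finset.Ico (k - R) k, b j) :
    ∀ K : ℕ, 1 ≤ K →
      (1 / (K : ℝ)) * ∑ k ∈ Finset.range K, a k ≤
        2 * F 0 / ((K : ℝ) * γ) + 2 * L * γ * σ2 := by
  intro K hK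
  have hwin := sum_range_sum_Ico_sub_le b hb R K
  have hB : 0 ≤ ∑ k ∈ Finset.range K, b k := Finset.sum_nonneg fun k _ => hb k
  have hsum := Finset.sum_le_sum fun k (_ : k ∈ Finset.range K) => sub_le_sub_right (hrec k) (F k)
  rw [Finset.sum_range_sub] at hsum
  simp only [Finset.sum_add_distrib, Finset.sum_sub_distrib, ← Finset.mul_sum, Finset.sum_const,
    Finset.card_range, nsmul_eq_mul] at hsum
  have hstep : L * γ * R ≤ 1 / 2 := by
    rcases Nat.eq_zero_or_pos R with rfl | hR
    · norm_num
    · have hR' : (0 : ℝ) < R := by exact_mod_cast hR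
      have h := hγR hR.ne'
      rw [le_div_iff₀ (by positivity)] at h
      linarith
  have hsq : (L * γ * R) ^ 2 ≤ 1 / 4 := by
    have h0 : 0 ≤ L * γ * R := by positivity
    nlinarith
  have hstale : L ^ 2 * γ ^ 3 * R *
      ∑ k ∈ Finset.range K, ∑ j ∈ Finset.Ico (k - R) k, b j ≤
        γ / 4 * ∑ k ∈ Finset.range K, b k :=
    calc
      _ ≤ L ^ 2 * γ ^ 3 * R * (R * ∑ k ∈ Finset.range K, b k) := by gcongr
      _ = (L * γ * R) ^ 2 * (γ * ∑ k ∈ Finset.range K, b k) := by ring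
      _ ≤ 1 / 4 * (γ * ∑ k ∈ Finset.range K, b k) := by gcongr
      _ = _ := by ring
  have hmain : γ / 2 * ∑ k ∈ Finset.range K, a k ≤ F 0 + K * (L * γ ^ 2 * σ2) := by
    linarith [hF K]
  have hK' : (0 : ℝ) < K := by exact_mod_cast hK
  calc
    1 / (K : ℝ) * ∑ k ∈ Finset.range K, a k
        = 2 / (K * γ) * (γ / 2 * ∑ k ∈ Finset.range K, a k) := by field_simp
    _ ≤ 2 / (K * γ) * (F 0 + K * (L * γ ^ 2 * σ2)) := by gcongr
    _ = 2 * F 0 / (K * γ) + 2 * L * γ * σ2 := by field_simp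
end

section
/- Let n ∈ ℕ with n ≥ 1, let 0 < h_1 ≤ h_2 ≤ … ≤ h_n be real numbers, let B ∈ ℕ with B ≥ 1, and set T := 2·min_{m ∈ {1,…,n}} [ (Σ_{i=1}^{m} 1/h_i)^{-1}·(B + m) ]. Then Σ_{i=1}^{n} max{ ⌊T/h_i⌋ − 1, 0 } ≥ B. -/
/-- Counting inequality underlying the computational time bound for Rennala SGD under
the `h_i`-fixed computation model: with
`T = 2·min_{m∈{1,…,n}} (Σ_{i=1}^m 1/h_i)⁻¹·(B + m)`, the `n` workers jointly produce at
least `B` usable stochastic gradients within `T` seconds. -/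
theorem rennala_counting
    (n : ℕ) (hn : 1 ≤ n) (h : ℕ → ℝ)
    (hpos : ∀ i, 1 ≤ i → i ≤ n → 0 < h i)
    (hmono : ∀ i, 1 ≤ i → i < n → h i ≤ h (i + 1))
    (B : ℕ) (hB : 1 ≤ B)
    (T : ℝ)
    (hT : T = 2 * (Finset.Icc 1 n).inf' (Finset.nonempty_Icc.mpr hn)
      (fun m => (∑ i ∈ Finset.Icc 1 m, 1 / h i)⁻¹ * ((B : ℝ) + (m : ℝ)))) :
    (B : ℤ) ≤ ∑ i ∈ Finset.Icc 1 n, max (⌊T / h i⌋ - 1) 0 := by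
  obtain ⟨m, hm, hmin⟩ := Finset.exists_mem_eq_inf' (Finset.nonempty_Icc.mpr hn)
    (fun m => (∑ i ∈ Finset.Icc 1 m, 1 / h i)⁻¹ * ((B : ℝ) + (m : ℝ)))
  rw [hmin] at hT
  obtain ⟨hm1, hmn⟩ := Finset.mem_Icc.mp hm
  have hS : 0 < ∑ i ∈ Finset.Icc 1 m, 1 / h i := by
    refine Finset.sum_pos (fun i hi => ?_) (Finset.nonempty_Icc.mpr hm1)
    obtain ⟨hi1, him⟩ := Finset.mem_Icc.mp hi
    exact one_div_pos.mpr (hpos i hi1 (him.trans hmn))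
  have hsum : ∑ i ∈ Finset.Icc 1 m, (T / h i - 2) = 2 * (B : ℝ) := by
    have hTS : ∑ i ∈ Finset.Icc 1 m, T / h i = 2 * ((B : ℝ) + m) := by
      calc ∑ i ∈ Finset.Icc 1 m, T / h i = T * ∑ i ∈ Finset.Icc 1 m, 1 / h i := by
            rw [Finset.mul_sum]
            exact Finset.sum_congr rfl fun i _ => by ring
        _ = 2 * ((B : ℝ) + m) := by
            rw [hT]
            field_simp
    rw [Finset.sum_sub_distrib, hTS]
    simp
    ring
  have hle : ∑ i ∈ Finset.Icc 1 m, (T / h i - 2) ≤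
      ((∑ i ∈ Finset.Icc 1 m, max (⌊T / h i⌋ - 1) 0 : ℤ) : ℝ) := by
    rw [Int.cast_sum]
    refine Finset.sum_le_sum fun i _ => ?_
    have hfloor := Int.lt_floor_add_one (T / h i)
    have hmax : ((⌊T / h i⌋ - 1 : ℤ) : ℝ) ≤ ((max (⌊T / h i⌋ - 1) 0 : ℤ) : ℝ) :=
      Int.cast_le.mpr (le_max_left _ _)
    push_cast at hmax ⊢
    linarith
  have hB_le : (B : ℤ) ≤ ∑ i ∈ Finset.Icc 1 m, max (⌊T / h i⌋ - 1) 0 := by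
    rw [hsum] at hle
    have h2B : 2 * (B : ℤ) ≤ ∑ i ∈ Finset.Icc 1 m, max (⌊T / h i⌋ - 1) 0 := by
      exact_mod_cast hle
    lia
  exact hB_le.trans <| Finset.sum_le_sum_of_subset_of_nonneg
    (Finset.Icc_subset_Icc_right hmn) fun i _ _ => le_max_right _ _
end

section
/- Let n ∈ ℕ with n ≥ 1, let 0 < h_1 ≤ h_2 ≤ … ≤ h_n be real numbers, let B, M ∈ ℕ with B, M ≥ 1, and set T := 2·min_{m ∈ {1,…,n}} [ (Σ_{i=1}^{m} 1/h_i)^{-1}·(B + M·m) ]. Then Σ_{i=1}^{n} max{ M·⌊T/(M·h_i)⌋ − M, 0 } ≥ B. -/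
/-- Counting inequality underlying the computational time bound for Async-Local SGD
under the `h_i`-fixed computation model: each worker contributes gradients in blocks of
size `M` taking at most `M·h_i` seconds per block, at most one block per worker may be
discarded, and with `T = 2·min_{m∈{1,…,n}} (Σ_{i=1}^m 1/h_i)⁻¹·(B + M·m)` the workers
jointly produce at least `B` usable stochastic gradients within `T` seconds. -/
theorem async_local_counting
    (n : ℕ) (hn : 1 ≤ n) (h : ℕ → ℝ)
    (hpos : ∀ i, 1 ≤ i → i ≤ n → 0 < h i)
    (hmono : ∀ i, 1 ≤ i → i < n → h i ≤ h (i + 1))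
    (B M : ℕ) (hB : 1 ≤ B) (hM : 1 ≤ M)
    (T : ℝ)
    (hT : T = 2 * (Finset.Icc 1 n).inf' (Finset.nonempty_Icc.mpr hn)
      (fun m => (∑ i ∈ Finset.Icc 1 m, 1 / h i)⁻¹ * ((B : ℝ) + (M : ℝ) * (m : ℝ)))) :
    (B : ℤ) ≤ ∑ i ∈ Finset.Icc 1 n, max ((M : ℤ) * ⌊T / ((M : ℝ) * h i)⌋ - (M : ℤ)) 0 := by
  obtain ⟨m, hm, hmin⟩ := Finset.exists_mem_eq_inf' (Finset.nonempty_Icc.mpr hn)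
    (fun m : ℕ => (∑ i ∈ Finset.Icc 1 m, 1 / h i)⁻¹ * ((B : ℝ) + (M : ℝ) * (m : ℝ)))
  rw [hmin] at hT
  obtain ⟨hm1, hmn⟩ := Finset.mem_Icc.mp hm
  have hM0 : (0 : ℝ) < M := by exact_mod_cast hM
  have hpos' : ∀ i ∈ Finset.Icc 1 m, 0 < h i := fun i hi =>
    hpos i (Finset.mem_Icc.mp hi).1 ((Finset.mem_Icc.mp hi).2.trans hmn)
  have hS : 0 < ∑ i ∈ Finset.Icc 1 m, 1 / h i :=
    Finset.sum_pos (fun i hi => one_div_pos.mpr (hpos' i hi)) (Finset.nonempty_Icc.mpr hm1)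
  have hTS : T * ∑ i ∈ Finset.Icc 1 m, 1 / h i = 2 * (B + M * m) := by
    rw [hT]
    field_simp
  have hblock : ∀ i ∈ Finset.Icc 1 m,
      T * (1 / h i) - 2 * M ≤ (M : ℝ) * ⌊T / ((M : ℝ) * h i)⌋ - M := by
    intro i hi
    have hi0 := hpos' i hi
    have hfloor := mul_le_mul_of_nonneg_left (Int.sub_one_lt_floor (T / (M * h i))).le hM0.le
    have hcancel : (M : ℝ) * (T / (M * h i) - 1) = T * (1 / h i) - M := by
      field_simp
    linarith
  have hsum : (B : ℝ) ≤ ∑ i ∈ Finset.Icc 1 m, ((M : ℝ) * ⌊T / ((M : ℝ) * h i)⌋ - M) := by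
    refine le_trans ?_ (Finset.sum_le_sum hblock)
    rw [Finset.sum_sub_distrib, ← Finset.mul_sum, hTS, Finset.sum_const, Nat.card_Icc,
      nsmul_eq_mul, Nat.add_sub_cancel]
    linarith [Nat.cast_nonneg (α := ℝ) B]
  calc (B : ℤ) ≤ ∑ i ∈ Finset.Icc 1 m, ((M : ℤ) * ⌊T / ((M : ℝ) * h i)⌋ - (M : ℤ)) := by
        exact_mod_cast hsum
    _ ≤ ∑ i ∈ Finset.Icc 1 m, max ((M : ℤ) * ⌊T / ((M : ℝ) * h i)⌋ - (M : ℤ)) 0 :=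
        Finset.sum_le_sum fun i _ => le_max_left _ _
    _ ≤ ∑ i ∈ Finset.Icc 1 n, max ((M : ℤ) * ⌊T / ((M : ℝ) * h i)⌋ - (M : ℤ)) 0 :=
        Finset.sum_le_sum_of_subset_of_nonneg (Finset.Icc_subset_Icc_right hmn)
          fun i _ _ => le_max_right _ _
end

section
/- Let n ∈ ℕ with n ≥ 1, let h_1, …, h_n and τ_1, …, τ_n be positive reals ordered so that max{h_1, τ_1} ≤ max{h_2, τ_2} ≤ … ≤ max{h_n, τ_n}, let B ∈ ℕ with B ≥ 1, and set T := 4·min_{m ∈ {1,…,n}} max{ max{h_m, τ_m}, (Σ_{i=1}^{m} 1/h_i)^{-1}·B }. Then for every m* ∈ {1, …, n} attaining this minimum, Σ_{i=1}^{m*} max{ ⌊T/h_i⌋ − 1, 0 } ≥ B. -/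
/-- If `h i ≤ a` on `s` and `2 * a + 2 * b ≤ T`, then the counts `⌊T / h i⌋ - 1`, truncated at `0`,
add up to at least `2 * b * ∑ i ∈ s, 1 / h i`. -/
theorem two_mul_mul_sum_one_div_le_sum_floor_sub_one {ι : Type*} (s : Finset ι) (h : ι → ℝ)
    {a b T : ℝ} (hpos : ∀ i ∈ s, 0 < h i) (hle : ∀ i ∈ s, h i ≤ a) (hT : 2 * a + 2 * b ≤ T) :
    2 * (b * ∑ i ∈ s, 1 / h i) ≤ ((∑ i ∈ s, max (⌊T / h i⌋ - 1) 0 : ℤ) : ℝ) := by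
  rw [Finset.mul_sum, Finset.mul_sum, Int.cast_sum]
  refine Finset.sum_le_sum fun i hi => ?_
  have hi0 := hpos i hi
  have hdiv : 2 + 2 * (b * (1 / h i)) ≤ T / h i := by
    rw [le_div_iff₀ hi0]
    field_simp
    linarith [hle i hi]
  have hmax : ((⌊T / h i⌋ - 1 : ℤ) : ℝ) ≤ ((max (⌊T / h i⌋ - 1) 0 : ℤ) : ℝ) :=
    Int.cast_le.mpr (le_max_left _ _)
  refine le_trans ?_ hmax
  push_cast
  linarith [Int.lt_floor_add_one (T / h i)]

/-- A sequence that is nondecreasing from each index in `[l, n)` to the next is monotone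
on `[l, n]`. -/
theorem le_of_le_succ_on_Icc {α : Type*} [Preorder α] {f : ℕ → α} {l n : ℕ}
    (hf : ∀ i, l ≤ i → i < n → f i ≤ f (i + 1)) {i j : ℕ} (hli : l ≤ i) (hij : i ≤ j)
    (hjn : j ≤ n) : f i ≤ f j := by
  induction j, hij using Nat.le_induction with
  | base => exact le_rfl
  | succ k hik ih => exact (ih (by lia)).trans (hf k (hli.trans hik) (by lia))

/-- Counting inequality underlying the total time bound for Dual-Process SGD under the
`(h_i, τ_i)`-fixed computation model: with
`T = 4·min_{m∈{1,…,n}} max{max{h_m, τ_m}, (Σ_{i=1}^m 1/h_i)⁻¹·B}`, for every `m*`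
attaining this minimum the first `m*` workers alone produce at least `B` usable
stochastic gradients within `T` seconds. -/
theorem dual_process_counting
    (n : ℕ) (hn : 1 ≤ n) (h τ : ℕ → ℝ)
    (hpos : ∀ i, 1 ≤ i → i ≤ n → 0 < h i)
    (hτpos : ∀ i, 1 ≤ i → i ≤ n → 0 < τ i)
    (hmono : ∀ i, 1 ≤ i → i < n → max (h i) (τ i) ≤ max (h (i + 1)) (τ (i + 1)))
    (B : ℕ) (hB : 1 ≤ B)
    (T : ℝ)
    (hT : T = 4 * (Finset.Icc 1 n).inf' (Finset.nonempty_Icc.mpr hn)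
      (fun m => max (max (h m) (τ m))
        ((∑ i ∈ Finset.Icc 1 m, 1 / h i)⁻¹ * (B : ℝ))))
    (mstar : ℕ) (hmstar : mstar ∈ Finset.Icc 1 n)
    (hmin : max (max (h mstar) (τ mstar))
        ((∑ i ∈ Finset.Icc 1 mstar, 1 / h i)⁻¹ * (B : ℝ))
      = (Finset.Icc 1 n).inf' (Finset.nonempty_Icc.mpr hn)
        (fun m => max (max (h m) (τ m))
          ((∑ i ∈ Finset.Icc 1 m, 1 / h i)⁻¹ * (B : ℝ)))) :
    (B : ℤ) ≤ ∑ i ∈ Finset.Icc 1 mstar, max (⌊T / h i⌋ - 1) 0 := by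
  obtain ⟨hm1, hmn⟩ := Finset.mem_Icc.mp hmstar
  have hpos' : ∀ i ∈ Finset.Icc 1 mstar, 0 < h i := fun i hi =>
    hpos i (Finset.mem_Icc.mp hi).1 ((Finset.mem_Icc.mp hi).2.trans hmn)
  have hle : ∀ i ∈ Finset.Icc 1 mstar, h i ≤ max (h mstar) (τ mstar) := fun i hi =>
    (le_max_left _ _).trans <|
      le_of_le_succ_on_Icc (f := fun i => max (h i) (τ i)) hmono
        (Finset.mem_Icc.mp hi).1 (Finset.mem_Icc.mp hi).2 hmn
  have hsum : 0 < ∑ i ∈ Finset.Icc 1 mstar, 1 / h i :=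
    Finset.sum_pos (fun i hi => one_div_pos.mpr (hpos' i hi)) (Finset.nonempty_Icc.mpr hm1)
  rw [← hmin] at hT
  have hcount := two_mul_mul_sum_one_div_le_sum_floor_sub_one (Finset.Icc 1 mstar) h (T := T)
    (b := (∑ i ∈ Finset.Icc 1 mstar, 1 / h i)⁻¹ * (B : ℝ)) hpos' hle (by
      rw [hT]
      linarith [le_max_left (max (h mstar) (τ mstar))
          ((∑ i ∈ Finset.Icc 1 mstar, 1 / h i)⁻¹ * (B : ℝ)),
        le_max_right (max (h mstar) (τ mstar))
          ((∑ i ∈ Finset.Icc 1 mstar, 1 / h i)⁻¹ * (B : ℝ))])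
  rw [mul_right_comm, inv_mul_cancel₀ hsum.ne', one_mul] at hcount
  have hB0 : (0 : ℝ) ≤ B := B.cast_nonneg
  have hreal : ((B : ℤ) : ℝ) ≤
      ((∑ i ∈ Finset.Icc 1 mstar, max (⌊T / h i⌋ - 1) 0 : ℤ) : ℝ) := by
    rw [Int.cast_natCast]
    linarith
  exact Int.cast_le.mp hreal
end

section
/- There is an absolute constant C > 0 (independent of all parameters) such that the following holds. Let n ∈ ℕ with n ≥ 1, let 0 < h_1 ≤ … ≤ h_n, and let L, Δ, ε > 0 and σ² ≥ 0 satisfy 2LΔ ≥ ε. Set B := max{⌈σ²/ε⌉, 1}, K := ⌈4BLΔ/ε + 8σ²LΔ/ε²⌉, and T_R(B) := 2·min_{m ∈ {1,…,n}} [ (Σ_{i=1}^{m} 1/h_i)^{-1}·(B + m) ]. Then T_R(B)·⌈K/B⌉ ≤ C·min_{m ∈ {1,…,n}} [ ((1/m)·Σ_{i=1}^{m} 1/h_i)^{-1}·( LΔ/ε + σ²LΔ/(m·ε²) ) ]. -/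
/-- The number of batches `⌈K/B⌉` is at most a constant multiple of `LΔ/ε`, here written `a`,
where `s` stands for `σ²/ε`. -/
lemma ceil_iterations_div_batch_le {a s : ℝ} (ha : 1 / 2 ≤ a) (hs : 0 ≤ s) {B K : ℕ}
    (hB : 1 ≤ B) (hsB : s ≤ B) (hK : K = ⌈4 * (B : ℝ) * a + 8 * s * a⌉₊) :
    (⌈(K : ℝ) / (B : ℝ)⌉₊ : ℝ) ≤ 16 * a := by
  have hB' : (1 : ℝ) ≤ B := by exact_mod_cast hB
  have hKlt : (K : ℝ) < 4 * (B : ℝ) * a + 8 * s * a + 1 :=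
    hK ▸ Nat.ceil_lt_add_one (by positivity)
  have hdiv : (K : ℝ) / B ≤ 12 * a + 1 := by
    rw [div_le_iff₀ (by positivity)]
    nlinarith [mul_le_mul_of_nonneg_right hsB (show 0 ≤ a by linarith)]
  have hceil : (⌈(K : ℝ) / (B : ℝ)⌉₊ : ℝ) < (K : ℝ) / B + 1 :=
    Nat.ceil_lt_add_one (by positivity)
  linarith

/-- Arithmetic content of the computational time-complexity theorem for Rennala SGD
under the `h_i`-fixed computation model: with `B = max{⌈σ²/ε⌉, 1}`,
`K = ⌈4BLΔ/ε + 8σ²LΔ/ε²⌉` and `T_R(B) = 2·min_m (Σ_{i≤m} 1/h_i)⁻¹·(B + m)`, the total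
time `T_R(B)·⌈K/B⌉` is within an absolute constant of the optimal complexity
`min_m ((1/m)·Σ_{i≤m} 1/h_i)⁻¹·(LΔ/ε + σ²LΔ/(mε²))`. -/
theorem rennala_time_complexity :
    ∃ C : ℝ, 0 < C ∧
      ∀ (n : ℕ) (hn : 1 ≤ n) (h : ℕ → ℝ),
        (∀ i, 1 ≤ i → i ≤ n → 0 < h i) →
        (∀ i, 1 ≤ i → i < n → h i ≤ h (i + 1)) →
      ∀ (L Δ ε σ2 : ℝ), 0 < L → 0 < Δ → 0 < ε → 0 ≤ σ2 → ε ≤ 2 * L * Δ →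
      ∀ (B K : ℕ), B = max ⌈σ2 / ε⌉₊ 1 →
        K = ⌈4 * (B : ℝ) * L * Δ / ε + 8 * σ2 * L * Δ / ε ^ 2⌉₊ →
      (2 * (Finset.Icc 1 n).inf' (Finset.nonempty_Icc.mpr hn)
          (fun m => (∑ i ∈ Finset.Icc 1 m, 1 / h i)⁻¹ * ((B : ℝ) + (m : ℝ))))
        * (⌈(K : ℝ) / (B : ℝ)⌉₊ : ℝ)
      ≤ C * (Finset.Icc 1 n).inf' (Finset.nonempty_Icc.mpr hn)
          (fun m => ((1 / (m : ℝ)) * ∑ i ∈ Finset.Icc 1 m, 1 / h i)⁻¹ *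
            (L * Δ / ε + σ2 * L * Δ / ((m : ℝ) * ε ^ 2))) := by
  refine ⟨64, by norm_num, ?_⟩
  intro n hn h hpos _ L Δ ε σ2 hL hΔ hε hσ hLΔ B K hB hK
  have hs : 0 ≤ σ2 / ε := by positivity
  have ha : 1 / 2 ≤ L * Δ / ε := by
    rw [le_div_iff₀ hε]
    linarith
  have hB1 : 1 ≤ B := hB ▸ le_max_right _ _
  have hsB : σ2 / ε ≤ B :=
    (Nat.le_ceil _).trans (by exact_mod_cast hB ▸ le_max_left _ _)
  have hBs : (B : ℝ) ≤ σ2 / ε + 1 := by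
    rw [hB, Nat.cast_max, Nat.cast_one]
    exact max_le (Nat.ceil_lt_add_one hs).le (by linarith)
  have hceil : (⌈(K : ℝ) / (B : ℝ)⌉₊ : ℝ) ≤ 16 * (L * Δ / ε) := by
    refine ceil_iterations_div_batch_le ha hs hB1 hsB ?_
    rw [hK]
    congr 1
    field_simp
  obtain ⟨m, hm, hmin⟩ := Finset.exists_mem_eq_inf' (Finset.nonempty_Icc.mpr hn)
    (fun m : ℕ => ((1 / (m : ℝ)) * ∑ i ∈ Finset.Icc 1 m, 1 / h i)⁻¹ *
      (L * Δ / ε + σ2 * L * Δ / ((m : ℝ) * ε ^ 2)))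
  rw [hmin]
  obtain ⟨hm1, hmn⟩ := Finset.mem_Icc.mp hm
  have hm' : (1 : ℝ) ≤ m := by exact_mod_cast hm1
  have hS : 0 ≤ (∑ i ∈ Finset.Icc 1 m, 1 / h i)⁻¹ :=
    inv_nonneg.mpr <| Finset.sum_nonneg fun i hi =>
      have hi' := Finset.mem_Icc.mp hi
      (one_div_pos.mpr (hpos i hi'.1 (hi'.2.trans hmn))).le
  have hbatch : (∑ i ∈ Finset.Icc 1 m, 1 / h i)⁻¹ * ((B : ℝ) + m) ≤
      (∑ i ∈ Finset.Icc 1 m, 1 / h i)⁻¹ * (2 * (σ2 / ε + m)) :=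
    mul_le_mul_of_nonneg_left (by linarith) hS
  calc
    _ ≤ (2 * ((∑ i ∈ Finset.Icc 1 m, 1 / h i)⁻¹ * (2 * (σ2 / ε + m)))) *
        (16 * (L * Δ / ε)) := by
      refine mul_le_mul ?_ hceil (Nat.cast_nonneg _) (by positivity)
      exact mul_le_mul_of_nonneg_left ((Finset.inf'_le _ hm).trans hbatch) zero_le_two
    _ = _ := by
      simp only [mul_inv, one_div, inv_inv]
      field_simp
      ring
end

section
/- There is an absolute constant C > 0 (independent of all parameters) such that the following holds. Let n ∈ ℕ with n ≥ 1, let 0 < h_1 ≤ … ≤ h_n, and let L, Δ, ε > 0 and σ² ≥ 0 satisfy 2LΔ ≥ ε. Set B := max{⌈σ²/ε⌉, 1}, M := max{⌈σ²/(nε)⌉, 1}, K := ⌈4(B + M − 1)LΔ/ε + 8σ²LΔ/ε²⌉, and T_{AL}(B, M) := 2·min_{m ∈ {1,…,n}} [ (Σ_{i=1}^{m} 1/h_i)^{-1}·(B + M·m) ]. Then T_{AL}(B, M)·⌈K/B⌉ ≤ C·min_{m ∈ {1,…,n}} [ ((1/m)·Σ_{i=1}^{m} 1/h_i)^{-1}·(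 LΔ/ε + σ²LΔ/(m·ε²) ) ]. -/
/-- The rounded-up quantity `max ⌈x⌉ 1` exceeds `x` by at most one. -/
lemma Nat.cast_max_ceil_one_le {x : ℝ} (hx : 0 ≤ x) : ((max ⌈x⌉₊ 1 : ℕ) : ℝ) ≤ x + 1 := by
  rw [Nat.cast_max, Nat.cast_one]
  exact max_le (Nat.ceil_lt_add_one hx).le (by linarith)

/-- The number of rounds `⌈K / B⌉` is at most `20 a` when `K = ⌈4(B+M-1)a + 8sa⌉`, where `a`
stands for `LΔ/ε` and `s` for `σ²/ε`. -/
lemma ceil_ceil_div_le {a s B M : ℝ} (ha : 1 ≤ 2 * a) (hs : 0 ≤ s) (hsB : s ≤ B) (hB : 1 ≤ B)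
    (hM : 1 ≤ M) (hMs : M ≤ s + 1) :
    (⌈(⌈4 * (B + M - 1) * a + 8 * s * a⌉₊ : ℝ) / B⌉₊ : ℝ) ≤ 20 * a := by
  have hB0 : 0 < B := by linarith
  have ha0 : 0 < a := by linarith
  have hnonneg : 0 ≤ 4 * (B + M - 1) * a + 8 * s * a := by
    have : 0 ≤ B + M - 1 := by linarith
    positivity
  have hK := Nat.ceil_lt_add_one hnonneg
  have hdiv : (⌈4 * (B + M - 1) * a + 8 * s * a⌉₊ : ℝ) / B ≤ 16 * a + 1 := by
    rw [div_le_iff₀ hB0]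
    have h1 : (4 * (B + M - 1) + 8 * s) * a ≤ 16 * B * a :=
      mul_le_mul_of_nonneg_right (by linarith) ha0.le
    linarith
  have hceil := Nat.ceil_lt_add_one
    (a := (⌈4 * (B + M - 1) * a + 8 * s * a⌉₊ : ℝ) / B) (by positivity)
  linarith


/-- Arithmetic content of the computational time-complexity theorem for Async-Local SGD
under the `h_i`-fixed computation model: with `B = max{⌈σ²/ε⌉, 1}`,
`M = max{⌈σ²/(nε)⌉, 1}`, `K = ⌈4(B+M−1)LΔ/ε + 8σ²LΔ/ε²⌉` and
`T_AL(B,M) = 2·min_m (Σ_{i≤m} 1/h_i)⁻¹·(B + M·m)`, the total time `T_AL(B,M)·⌈K/B⌉` is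
within an absolute constant of the optimal complexity. -/
theorem async_local_time_complexity :
    ∃ C : ℝ, 0 < C ∧
      ∀ (n : ℕ) (hn : 1 ≤ n) (h : ℕ → ℝ),
        (∀ i, 1 ≤ i → i ≤ n → 0 < h i) →
        (∀ i, 1 ≤ i → i < n → h i ≤ h (i + 1)) →
      ∀ (L Δ ε σ2 : ℝ), 0 < L → 0 < Δ → 0 < ε → 0 ≤ σ2 → ε ≤ 2 * L * Δ →
      ∀ (B M K : ℕ), B = max ⌈σ2 / ε⌉₊ 1 → M = max ⌈σ2 / ((n : ℝ) * ε)⌉₊ 1 →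
        K = ⌈4 * ((B : ℝ) + (M : ℝ) - 1) * L * Δ / ε + 8 * σ2 * L * Δ / ε ^ 2⌉₊ →
      (2 * (Finset.Icc 1 n).inf' (Finset.nonempty_Icc.mpr hn)
          (fun m => (∑ i ∈ Finset.Icc 1 m, 1 / h i)⁻¹ * ((B : ℝ) + (M : ℝ) * (m : ℝ))))
        * (⌈(K : ℝ) / (B : ℝ)⌉₊ : ℝ)
      ≤ C * (Finset.Icc 1 n).inf' (Finset.nonempty_Icc.mpr hn)
          (fun m => ((1 / (m : ℝ)) * ∑ i ∈ Finset.Icc 1 m, 1 / h i)⁻¹ *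
            (L * Δ / ε + σ2 * L * Δ / ((m : ℝ) * ε ^ 2))) := by
  refine ⟨80, by norm_num, ?_⟩
  intro n hn h hpos _ L Δ ε σ2 hL hΔ hε hσ hLΔ B M K hB hM hK
  have hn0 : (0 : ℝ) < n := by exact_mod_cast hn
  obtain ⟨s, hs⟩ : ∃ s, s = σ2 / ε := ⟨_, rfl⟩
  obtain ⟨a, ha⟩ : ∃ a, a = L * Δ / ε := ⟨_, rfl⟩
  have hs0 : 0 ≤ s := hs ▸ by positivity
  have ha1 : 1 ≤ 2 * a := by
    rw [ha, ← mul_div_assoc, le_div_iff₀ hε]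
    linarith
  have hB1 : (1 : ℝ) ≤ B := by exact_mod_cast hB ▸ le_max_right _ _
  have hM1 : (1 : ℝ) ≤ M := by exact_mod_cast hM ▸ le_max_right _ _
  have hsB : s ≤ B := by
    rw [hB, ← hs]
    exact (Nat.le_ceil s).trans (by exact_mod_cast le_max_left _ _)
  have hBs : (B : ℝ) ≤ s + 1 := by
    rw [hB, ← hs]
    exact Nat.cast_max_ceil_one_le hs0
  have hMs : (M : ℝ) ≤ s / n + 1 := by
    rw [hM, mul_comm, ← div_div, ← hs]
    exact Nat.cast_max_ceil_one_le (by positivity)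
  have hsn : s / n ≤ s := div_le_self hs0 (by exact_mod_cast hn)
  have hrounds : (⌈(K : ℝ) / (B : ℝ)⌉₊ : ℝ) ≤ 20 * a := by
    have hKeq : 4 * ((B : ℝ) + (M : ℝ) - 1) * L * Δ / ε + 8 * σ2 * L * Δ / ε ^ 2
        = 4 * ((B : ℝ) + (M : ℝ) - 1) * a + 8 * s * a := by
      rw [ha, hs]
      field_simp
    rw [hK, hKeq]
    exact ceil_ceil_div_le ha1 hs0 hsB hB1 hM1 (by linarith)
  obtain ⟨m, hm, hmin⟩ := Finset.exists_mem_eq_inf' (Finset.nonempty_Icc.mpr hn)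
    (fun m : ℕ => ((1 / (m : ℝ)) * ∑ i ∈ Finset.Icc 1 m, 1 / h i)⁻¹ *
      (L * Δ / ε + σ2 * L * Δ / ((m : ℝ) * ε ^ 2)))
  rw [hmin]
  have hle := Finset.inf'_le
    (fun m : ℕ => (∑ i ∈ Finset.Icc 1 m, 1 / h i)⁻¹ * ((B : ℝ) + (M : ℝ) * (m : ℝ))) hm
  obtain ⟨hm1, hmn⟩ := Finset.mem_Icc.mp hm
  have hm1' : (1 : ℝ) ≤ m := by exact_mod_cast hm1
  have hm0 : (0 : ℝ) < m := by linarith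
  have hmn' : (m : ℝ) ≤ n := by exact_mod_cast hmn
  have hS : 0 < ∑ i ∈ Finset.Icc 1 m, 1 / h i := by
    refine Finset.sum_pos (fun i hi => ?_) (Finset.nonempty_Icc.mpr hm1)
    rw [Finset.mem_Icc] at hi
    exact one_div_pos.mpr (hpos i hi.1 (hi.2.trans hmn))
  have hrhs : ((1 / (m : ℝ)) * ∑ i ∈ Finset.Icc 1 m, 1 / h i)⁻¹ *
      (L * Δ / ε + σ2 * L * Δ / ((m : ℝ) * ε ^ 2))
      = (∑ i ∈ Finset.Icc 1 m, 1 / h i)⁻¹ * (a * (m + s)) := by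
    generalize ∑ i ∈ Finset.Icc 1 m, 1 / h i = S at hS
    rw [ha, hs]
    field_simp
  have hbatch : (B : ℝ) + M * m ≤ 2 * (m + s) := by
    have h1 : (M : ℝ) * m ≤ (s / n + 1) * m := mul_le_mul_of_nonneg_right hMs hm0.le
    have h2 : s / n * m ≤ s / n * n := mul_le_mul_of_nonneg_left hmn' (by positivity)
    rw [div_mul_cancel₀ s hn0.ne'] at h2
    linarith
  rw [hrhs]
  generalize ∑ i ∈ Finset.Icc 1 m, 1 / h i = S at hS hle
  calc _ ≤ (2 * (S⁻¹ * (2 * (m + s)))) * (20 * a) := by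
        gcongr
        exact hle.trans (mul_le_mul_of_nonneg_left hbatch (by positivity))
    _ = 80 * (S⁻¹ * (a * (m + s))) := by ring
end

section
/- There is an absolute constant C > 0 (independent of all parameters) such that the following holds. Let n ∈ ℕ with n ≥ 1, let h_1, …, h_n, τ_1, …, τ_n be positive reals with max{h_1, τ_1} ≤ … ≤ max{h_n, τ_n}, and let L, Δ, ε > 0 and σ² ≥ 0 satisfy 2LΔ ≥ ε. Set B := max{⌈σ²/ε⌉, 1}, K := ⌈4BLΔ/ε + 8σ²LΔ/ε²⌉, and T(B) := 4·min_{m ∈ {1,…,n}} max{ max{h_m, τ_m}, (Σ_{i=1}^{m} 1/h_i)^{-1}·B }. Then T(B)·⌈K/B⌉ ≤ C·( min_{m ∈ {1,…,n}} max{ max{h_m, τ_m}, (Σ_{i=1}^{m} 1/h_i)^{-1}·(σ²/ε) } )·(LΔ/ε). -/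
/-- The parallel combination of positive numbers is at most each of them. -/
lemma inv_sum_one_div_le {ι : Type*} {s : Finset ι} {h : ι → ℝ} (hpos : ∀ i ∈ s, 0 < h i)
    {m : ι} (hm : m ∈ s) : (∑ i ∈ s, 1 / h i)⁻¹ ≤ h m := by
  have hle : 1 / h m ≤ ∑ i ∈ s, 1 / h i :=
    Finset.single_le_sum (f := fun i => 1 / h i)
      (fun i hi => (one_div_pos.mpr (hpos i hi)).le) hm
  simpa using inv_anti₀ (one_div_pos.mpr (hpos m hm)) hle

lemma max_mul_le_two_mul_max {a b c d : ℝ} (ha : 0 ≤ a) (hab : a ≤ b) (hcd : c ≤ d + 1) :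
    max b (a * c) ≤ 2 * max b (a * d) := by
  have hb := le_max_left b (a * d)
  have hd := le_max_right b (a * d)
  have hc := mul_le_mul_of_nonneg_left hcd ha
  exact max_le (by linarith) (by linarith)

/-- The number of rounds `⌈K / B⌉` is at most `16 * x`, where `x = LΔ/ε` and `s = σ²/ε`. -/
lemma ceil_ceil_div_le_s16 {b s x : ℝ} (hb : 1 ≤ b) (hsb : s ≤ b) (hs : 0 ≤ s) (hx : 1 ≤ 2 * x) :
    (⌈(⌈4 * b * x + 8 * s * x⌉₊ : ℝ) / b⌉₊ : ℝ) ≤ 16 * x := by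
  have hb0 : 0 < b := one_pos.trans_le hb
  have hx0 : 0 ≤ x := by linarith
  have hK := (Nat.ceil_lt_add_one (by positivity : 0 ≤ 4 * b * x + 8 * s * x)).le
  have hdiv : (⌈4 * b * x + 8 * s * x⌉₊ : ℝ) / b ≤ 12 * x + 1 := by
    rw [div_le_iff₀ hb0]
    nlinarith [mul_le_mul_of_nonneg_right hsb hx0]
  have hceil := Nat.ceil_lt_add_one
    (by positivity : 0 ≤ (⌈4 * b * x + 8 * s * x⌉₊ : ℝ) / b)
  linarith

/-- Arithmetic content of the total time-complexity theorem for Dual-Process SGD under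
the `(h_i, τ_i)`-fixed computation model: with `B = max{⌈σ²/ε⌉, 1}`,
`K = ⌈4BLΔ/ε + 8σ²LΔ/ε²⌉` and
`T(B) = 4·min_m max{max{h_m, τ_m}, (Σ_{i≤m} 1/h_i)⁻¹·B}`, the total time `T(B)·⌈K/B⌉`
is within an absolute constant of
`(min_m max{max{h_m, τ_m}, (Σ_{i≤m} 1/h_i)⁻¹·(σ²/ε)})·(LΔ/ε)`. -/
theorem dual_process_time_complexity :
    ∃ C : ℝ, 0 < C ∧
      ∀ (n : ℕ) (hn : 1 ≤ n) (h τ : ℕ → ℝ),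
        (∀ i, 1 ≤ i → i ≤ n → 0 < h i) →
        (∀ i, 1 ≤ i → i ≤ n → 0 < τ i) →
        (∀ i, 1 ≤ i → i < n → max (h i) (τ i) ≤ max (h (i + 1)) (τ (i + 1))) →
      ∀ (L Δ ε σ2 : ℝ), 0 < L → 0 < Δ → 0 < ε → 0 ≤ σ2 → ε ≤ 2 * L * Δ →
      ∀ (B K : ℕ), B = max ⌈σ2 / ε⌉₊ 1 →
        K = ⌈4 * (B : ℝ) * L * Δ / ε + 8 * σ2 * L * Δ / ε ^ 2⌉₊ →
      (4 * (Finset.Icc 1 n).inf' (Finset.nonempty_Icc.mpr hn)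
          (fun m => max (max (h m) (τ m))
            ((∑ i ∈ Finset.Icc 1 m, 1 / h i)⁻¹ * (B : ℝ))))
        * (⌈(K : ℝ) / (B : ℝ)⌉₊ : ℝ)
      ≤ C * ((Finset.Icc 1 n).inf' (Finset.nonempty_Icc.mpr hn)
          (fun m => max (max (h m) (τ m))
            ((∑ i ∈ Finset.Icc 1 m, 1 / h i)⁻¹ * (σ2 / ε))))
          * (L * Δ / ε) := by
  refine ⟨128, by norm_num, ?_⟩
  intro n hn h τ hh _ _ L Δ ε σ2 hL hΔ hε hσ hLΔ B K hB hK
  have hs : 0 ≤ σ2 / ε := by positivity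
  have hx : 1 ≤ 2 * (L * Δ / ε) := by
    rw [← mul_div_assoc, le_div_iff₀ hε]
    linarith
  have hB1 : (1 : ℝ) ≤ B := by exact_mod_cast hB ▸ le_max_right _ _
  have hsB : σ2 / ε ≤ B := (Nat.le_ceil _).trans (by exact_mod_cast hB ▸ le_max_left _ _)
  have hBs : (B : ℝ) ≤ σ2 / ε + 1 := by
    rw [hB, Nat.cast_max, Nat.cast_one]
    exact max_le (Nat.ceil_lt_add_one hs).le (by linarith)
  have hrounds : (⌈(K : ℝ) / (B : ℝ)⌉₊ : ℝ) ≤ 16 * (L * Δ / ε) := by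
    have hKx : 4 * (B : ℝ) * L * Δ / ε + 8 * σ2 * L * Δ / ε ^ 2 =
        4 * B * (L * Δ / ε) + 8 * (σ2 / ε) * (L * Δ / ε) := by
      field_simp
    rw [hK, hKx]
    exact ceil_ceil_div_le_s16 hB1 hsB hs hx
  have hinv : ∀ m ∈ Finset.Icc 1 n, 0 ≤ (∑ i ∈ Finset.Icc 1 m, 1 / h i)⁻¹ ∧
      (∑ i ∈ Finset.Icc 1 m, 1 / h i)⁻¹ ≤ max (h m) (τ m) := by
    intro m hm
    obtain ⟨hm1, hmn⟩ := Finset.mem_Icc.mp hm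
    have hpos : ∀ i ∈ Finset.Icc 1 m, 0 < h i := fun i hi =>
      hh i (Finset.mem_Icc.mp hi).1 ((Finset.mem_Icc.mp hi).2.trans hmn)
    exact ⟨inv_nonneg.mpr (Finset.sum_nonneg fun i hi => (one_div_pos.mpr (hpos i hi)).le),
      (inv_sum_one_div_le hpos (Finset.mem_Icc.mpr ⟨hm1, le_rfl⟩)).trans (le_max_left _ _)⟩
  set F : ℝ → ℝ := fun c => (Finset.Icc 1 n).inf' (Finset.nonempty_Icc.mpr hn)
    (fun m => max (max (h m) (τ m)) ((∑ i ∈ Finset.Icc 1 m, 1 / h i)⁻¹ * c)) with hF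
  have hmin : F B ≤ 2 * F (σ2 / ε) := by
    obtain ⟨m, hm, hmF⟩ := Finset.exists_mem_eq_inf' (Finset.nonempty_Icc.mpr hn)
      (fun m => max (max (h m) (τ m)) ((∑ i ∈ Finset.Icc 1 m, 1 / h i)⁻¹ * (σ2 / ε)))
    simp only [hF]
    rw [hmF]
    exact (Finset.inf'_le _ hm).trans
      (max_mul_le_two_mul_max (hinv m hm).1 (hinv m hm).2 hBs)
  have hF0 : 0 ≤ F (σ2 / ε) :=
    Finset.le_inf' _ _ fun m hm => ((hinv m hm).1.trans (hinv m hm).2).trans (le_max_left _ _)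
  calc 4 * F B * (⌈(K : ℝ) / (B : ℝ)⌉₊ : ℝ)
      ≤ 4 * (2 * F (σ2 / ε)) * (16 * (L * Δ / ε)) := by gcongr
    _ = 128 * F (σ2 / ε) * (L * Δ / ε) := by ring
end

section
/- For all positive reals L, Δ, σ, ε, n, τ, h and every real K ≥ 1: τ·( LΔ/ε + Lσ²Δ/(nKε²) + LσΔ/(K^{1/2}·ε^{3/2}) ) + h·K·( LΔ/ε + Lσ²Δ/(nKε²) + LσΔ/(K^{1/2}·ε^{3/2}) ) ≥ 2·√(τh)·LσΔ/ε^{3/2} + τ·LΔ/ε + h·( LΔ/ε + σ²LΔ/(nε²) ). -/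
/-- Young's inequality for the product of square roots, with weight `s`. -/
theorem two_mul_sqrt_mul_le_div_add_mul {a b s : ℝ} (ha : 0 ≤ a) (hb : 0 ≤ b) (hs : 0 < s) :
    2 * Real.sqrt (a * b) ≤ a / s + b * s := by
  have hsq := two_mul_le_add_sq (Real.sqrt (a / s)) (Real.sqrt (b * s))
  rw [Real.sq_sqrt (by positivity), Real.sq_sqrt (by positivity), mul_assoc,
    ← Real.sqrt_mul (by positivity)] at hsq
  rwa [show a / s * (b * s) = a * b by field_simp] at hsq

/-- Lower bound on the total running time of the canonical Local SGD (FedAvg) with `K`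
local steps per round under the `(h, τ)`-fixed computation model: for every `K ≥ 1` the
implied time dominates `2√(τh)·LσΔ/ε^{3/2} + τ·LΔ/ε + h·(LΔ/ε + σ²LΔ/(nε²))`
(here `ε^{3/2} = ε·√ε`). -/
theorem canonical_local_sgd_time_lower_bound
    (L Δ σ ε n τ h K : ℝ)
    (hL : 0 < L) (hΔ : 0 < Δ) (hσ : 0 < σ) (hε : 0 < ε) (hn : 0 < n)
    (hτ : 0 < τ) (hh : 0 < h) (hK : 1 ≤ K) :
    2 * Real.sqrt (τ * h) * (L * σ * Δ) / (ε * Real.sqrt ε)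
        + τ * (L * Δ / ε)
        + h * (L * Δ / ε + σ ^ 2 * L * Δ / (n * ε ^ 2))
      ≤ τ * (L * Δ / ε + L * σ ^ 2 * Δ / (n * K * ε ^ 2)
              + L * σ * Δ / (Real.sqrt K * (ε * Real.sqrt ε)))
        + h * K * (L * Δ / ε + L * σ ^ 2 * Δ / (n * K * ε ^ 2)
              + L * σ * Δ / (Real.sqrt K * (ε * Real.sqrt ε))) := by
  have hK₀ : 0 < K := one_pos.trans_le hK
  have hs : 0 < Real.sqrt K := Real.sqrt_pos.2 hK₀
  have hr : 0 < Real.sqrt ε := Real.sqrt_pos.2 hε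
  have hKs : K / Real.sqrt K = Real.sqrt K := Real.div_sqrt
  have drift : 2 * Real.sqrt (τ * h) * (L * σ * Δ) / (ε * Real.sqrt ε)
      ≤ (τ + h * K) * (L * σ * Δ / (Real.sqrt K * (ε * Real.sqrt ε))) := by
    calc 2 * Real.sqrt (τ * h) * (L * σ * Δ) / (ε * Real.sqrt ε)
        ≤ (τ / Real.sqrt K + h * Real.sqrt K) * (L * σ * Δ) / (ε * Real.sqrt ε) := by
          gcongr
          exact two_mul_sqrt_mul_le_div_add_mul hτ.le hh.le hs
      _ = (τ / Real.sqrt K + h * (K / Real.sqrt K)) * (L * σ * Δ) / (ε * Real.sqrt ε) := by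
          rw [hKs]
      _ = (τ + h * K) * (L * σ * Δ / (Real.sqrt K * (ε * Real.sqrt ε))) := by
          field_simp
  have noise : h * (σ ^ 2 * L * Δ / (n * ε ^ 2))
      = h * K * (L * σ ^ 2 * Δ / (n * K * ε ^ 2)) := by
    field_simp
  have smooth : h * (L * Δ / ε) ≤ h * K * (L * Δ / ε) := by
    gcongr
    exact le_mul_of_one_le_right hh.le hK
  have comm_noise : 0 ≤ τ * (L * σ ^ 2 * Δ / (n * K * ε ^ 2)) := by positivity
  linarith
end
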